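/- Suppose m distinct points x_1,…,x_m ∈ ℝ^s and Y = [y_j^k] ∈ ℝ^{t×m} with Y ≠ 0 are given, and the functions K_k(x_j,·), j ∈ {1,…,m}, k ∈ {1,…,t}, are linearly independent in C₀(Θ). Let ĉ ∈ ℝ^{t×m} be a solution of the dual problem, C* its optimal value, and ĝ(θ) := C*·Σ_{k=1}^t Σ_{j=1}^m ĉ_{kj} K_k(x_j,θ). Then for every extreme point μ̂ of the solution set of the measure MNI problem inf{‖μ‖_TV : μ ∈ M(Θ), ∫_Θ K_k(x_j,θ) dμ(θ) = y_j^k for all j, k}, there exist γ_1,…,γ_{tm} ∈ ℝ with Σ_{ℓ=1}^{tm} γ_ℓ = ‖ĝ‖_∞ and points θ_1,…,θ_{tm} ∈ Θ(ĝ) such that μ̂ = Σ_{ℓ=1}^{tm} γ_ℓ · sign(ĝ(θ_ℓ)) · δ_{θ_ℓ}. -/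

import Mathlib

open MeasureTheory Filter Topology
open scoped ZeroAtInfty BigOperators

noncomputable section

/-- The parameter space of a depth-`D` deep neural network with layer widths
`m 0, m 1, …, m D` (input dimension `m 0 = s`, output dimension `m D = t`). -/
abbrev Params (m : ℕ → ℕ) (D : ℕ) : Type :=
  (j : Fin D) → ((Fin (m (j.1 + 1)) → Fin (m j.1) → ℝ) × (Fin (m (j.1 + 1)) → ℝ))

/-- The deep neural network `N(x, θ)` of depth `D`, defined recursively by
`N¹(x) = W₁ x + b₁` and `N^{j+1}(x) = W_{j+1} σ(N^j(x)) + b_{j+1}`. -/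
def NNet (σ : ℝ → ℝ) (m : ℕ → ℕ) :
    (D : ℕ) → Params m D → (Fin (m 0) → ℝ) → Fin (m D) → ℝ
  | 0, _, x => x
  | 1, θ, x => fun i => (∑ k, (θ ⟨0, Nat.one_pos⟩).1 i k * x k) + (θ ⟨0, Nat.one_pos⟩).2 i
  | (D + 2), θ, x => fun i =>
      (∑ k, (θ (Fin.last (D + 1))).1 i k *
          σ (NNet σ m (D + 1) (fun j => θ j.castSucc) x k))
        + (θ (Fin.last (D + 1))).2 i

/-- The integral of a function against a finite signed (Radon) measure,
via the Jordan decomposition. -/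
def sInt {Θ : Type*} [MeasurableSpace Θ] (μ : SignedMeasure Θ) (f : Θ → ℝ) : ℝ :=
  (∫ θ, f θ ∂μ.toJordanDecomposition.posPart) - ∫ θ, f θ ∂μ.toJordanDecomposition.negPart

/-- The total variation norm of a signed measure. -/
def tvNorm {Θ : Type*} [MeasurableSpace Θ] (μ : SignedMeasure Θ) : ℝ :=
  (μ.totalVariation Set.univ).toReal

/-- `f_μ^k(x) := ∫_Θ N_k(x,θ) ρ(θ) dμ(θ)`. -/
def fMu (σ : ℝ → ℝ) (m : ℕ → ℕ) (D : ℕ) (ρ : Params m D → ℝ)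
    (μ : SignedMeasure (Params m D)) : (Fin (m 0) → ℝ) → Fin (m D) → ℝ :=
  fun x k => sInt μ fun θ => NNet σ m D θ x k * ρ θ

/-- The set `B_N = {f_μ : μ ∈ M(Θ)}`. -/
def BNset (σ : ℝ → ℝ) (m : ℕ → ℕ) (D : ℕ) (ρ : Params m D → ℝ) :
    Set ((Fin (m 0) → ℝ) → Fin (m D) → ℝ) :=
  {f | ∃ μ : SignedMeasure (Params m D), fMu σ m D ρ μ = f}

/-- The norm `‖f‖_{B_N} = inf {‖ν‖_TV : f_ν = f}`. -/
def BNnorm (σ : ℝ → ℝ) (m : ℕ → ℕ) (D : ℕ) (ρ : Params m D → ℝ)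
    (f : (Fin (m 0) → ℝ) → Fin (m D) → ℝ) : ℝ :=
  sInf (tvNorm '' {ν : SignedMeasure (Params m D) | fMu σ m D ρ ν = f})

/-- `S`: the closed linear span in `C₀(Θ)` of the functions `θ ↦ N_k(x,θ)ρ(θ)`
(given here as the bundled family `Kb`). -/
def Sspan (m : ℕ → ℕ) (D : ℕ)
    (Kb : (Fin (m 0) → ℝ) → Fin (m D) → C₀(Params m D, ℝ)) :
    Submodule ℝ C₀(Params m D, ℝ) :=
  (Submodule.span ℝ
    (Set.range fun p : (Fin (m 0) → ℝ) × Fin (m D) => Kb p.1 p.2)).topologicalClosure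

/-- `V_N := span {K_k(x_j, ·) : j, k}`. -/
def VN (m : ℕ → ℕ) (D : ℕ)
    (Kb : (Fin (m 0) → ℝ) → Fin (m D) → C₀(Params m D, ℝ))
    (M : ℕ) (x : Fin M → (Fin (m 0) → ℝ)) : Submodule ℝ C₀(Params m D, ℝ) :=
  Submodule.span ℝ (Set.range fun p : Fin (m D) × Fin M => Kb (x p.2) p.1)

/-- The interpolation condition `f(x_j) = y_j`, i.e. `f_k(x_j) = y_j^k` for all `j, k`. -/
def interpolates (m : ℕ → ℕ) (D : ℕ) (M : ℕ) (x : Fin M → (Fin (m 0) → ℝ))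
    (Y : Fin (m D) → Fin M → ℝ) (f : (Fin (m 0) → ℝ) → Fin (m D) → ℝ) : Prop :=
  ∀ (j : Fin M) (k : Fin (m D)), f (x j) k = Y k j

/-- The solution set `S_{X,Y}` of the MNI problem
`inf {‖f‖_{B_N} : f ∈ B_N, f(x_j) = y_j}`. -/
def MNISolSet (σ : ℝ → ℝ) (m : ℕ → ℕ) (D : ℕ) (ρ : Params m D → ℝ)
    (M : ℕ) (x : Fin M → (Fin (m 0) → ℝ)) (Y : Fin (m D) → Fin M → ℝ) :
    Set ((Fin (m 0) → ℝ) → Fin (m D) → ℝ) :=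
  {f | f ∈ BNset σ m D ρ ∧ interpolates m D M x Y f ∧
    ∀ μ : SignedMeasure (Params m D), interpolates m D M x Y (fMu σ m D ρ μ) →
      BNnorm σ m D ρ f ≤ BNnorm σ m D ρ (fMu σ m D ρ μ)}

/-- The solution set of the measure MNI problem
`inf {‖μ‖_TV : μ ∈ M(Θ), ∫ K_k(x_j,·) dμ = y_j^k}`. -/
def MeasSolSet (σ : ℝ → ℝ) (m : ℕ → ℕ) (D : ℕ) (ρ : Params m D → ℝ)
    (M : ℕ) (x : Fin M → (Fin (m 0) → ℝ)) (Y : Fin (m D) → Fin M → ℝ) :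
    Set (SignedMeasure (Params m D)) :=
  {μ | interpolates m D M x Y (fMu σ m D ρ μ) ∧
    ∀ ν : SignedMeasure (Params m D), interpolates m D M x Y (fMu σ m D ρ ν) →
      tvNorm μ ≤ tvNorm ν}

/-- The subdifferential `∂‖·‖_∞(g) ⊆ B_N` of the supremum norm at `g ∈ S`, viewing `B_N`
as the dual of `S` via the (representation independent) pairing `⟨f_μ, g⟩ = ∫ g dμ`:
`∂‖·‖_∞(g) = {f_μ ∈ B_N : ‖f_μ‖_{B_N} = 1, ∫ g dμ = ‖g‖_∞}`. -/
def subdiffSup (σ : ℝ → ℝ) (m : ℕ → ℕ) (D : ℕ) (ρ : Params m D → ℝ)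
    (g : C₀(Params m D, ℝ)) : Set ((Fin (m 0) → ℝ) → Fin (m D) → ℝ) :=
  {f | f ∈ BNset σ m D ρ ∧ BNnorm σ m D ρ f = 1 ∧
    ∀ μ : SignedMeasure (Params m D), fMu σ m D ρ μ = f → sInt μ (fun θ => g θ) = ‖g‖}

/-- Feasibility for the dual problem: `‖∑_{k,j} c_{kj} K_k(x_j,·)‖_∞ = 1`. -/
def dualFeasible (m : ℕ → ℕ) (D : ℕ)
    (Kb : (Fin (m 0) → ℝ) → Fin (m D) → C₀(Params m D, ℝ))
    (M : ℕ) (x : Fin M → (Fin (m 0) → ℝ)) (c : Fin (m D) → Fin M → ℝ) : Prop :=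
  ‖∑ k, ∑ j, c k j • Kb (x j) k‖ = 1

/-- The objective `∑_{k,j} c_{kj} y_j^k` of the dual problem. -/
def dualObjective (m : ℕ → ℕ) (D : ℕ) (M : ℕ) (Y : Fin (m D) → Fin M → ℝ)
    (c : Fin (m D) → Fin M → ℝ) : ℝ :=
  ∑ k, ∑ j, c k j * Y k j

/-- `c` is a solution of the dual problem. -/
def dualSolves (m : ℕ → ℕ) (D : ℕ)
    (Kb : (Fin (m 0) → ℝ) → Fin (m D) → C₀(Params m D, ℝ))
    (M : ℕ) (x : Fin M → (Fin (m 0) → ℝ)) (Y : Fin (m D) → Fin M → ℝ)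
    (c : Fin (m D) → Fin M → ℝ) : Prop :=
  dualFeasible m D Kb M x c ∧
    ∀ c' : Fin (m D) → Fin M → ℝ, dualFeasible m D Kb M x c' →
      dualObjective m D M Y c' ≤ dualObjective m D M Y c

/-- `ĝ := C* · ∑_{k,j} ĉ_{kj} K_k(x_j,·)`, where `C*` is the optimal dual value
(the value of the dual objective at the dual solution `c`). -/
def ghat (m : ℕ → ℕ) (D : ℕ)
    (Kb : (Fin (m 0) → ℝ) → Fin (m D) → C₀(Params m D, ℝ))
    (M : ℕ) (x : Fin M → (Fin (m 0) → ℝ)) (Y : Fin (m D) → Fin M → ℝ)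
    (c : Fin (m D) → Fin M → ℝ) : C₀(Params m D, ℝ) :=
  dualObjective m D M Y c • ∑ k, ∑ j, c k j • Kb (x j) k

/-- `Θ(g) := {θ ∈ Θ : |g(θ)| = ‖g‖_∞}`. -/
def ThetaSet (m : ℕ → ℕ) (D : ℕ) (g : C₀(Params m D, ℝ)) : Set (Params m D) :=
  {θ | |g θ| = ‖g‖}

/-- The regularization objective `Q(I_X(f) − Y) + λ ‖f‖_{B_N}`. -/
def regObj (σ : ℝ → ℝ) (m : ℕ → ℕ) (D : ℕ) (ρ : Params m D → ℝ)
    (M : ℕ) (x : Fin M → (Fin (m 0) → ℝ)) (Y : Fin (m D) → Fin M → ℝ)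
    (lam : ℝ) (Q : (Fin (m D) → Fin M → ℝ) → ℝ)
    (f : (Fin (m 0) → ℝ) → Fin (m D) → ℝ) : ℝ :=
  Q ((fun k j => f (x j) k) - Y) + lam * BNnorm σ m D ρ f

/-- The solution set `R_{X,Y}` of the regularization problem. -/
def RegSolSet (σ : ℝ → ℝ) (m : ℕ → ℕ) (D : ℕ) (ρ : Params m D → ℝ)
    (M : ℕ) (x : Fin M → (Fin (m 0) → ℝ)) (Y : Fin (m D) → Fin M → ℝ)
    (lam : ℝ) (Q : (Fin (m D) → Fin M → ℝ) → ℝ) :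
    Set ((Fin (m 0) → ℝ) → Fin (m D) → ℝ) :=
  {f | f ∈ BNset σ m D ρ ∧
    ∀ μ : SignedMeasure (Params m D),
      regObj σ m D ρ M x Y lam Q f ≤ regObj σ m D ρ M x Y lam Q (fMu σ m D ρ μ)}

/-- `D_{X,Y} := I_X(R_{X,Y})`. -/
def DXY (σ : ℝ → ℝ) (m : ℕ → ℕ) (D : ℕ) (ρ : Params m D → ℝ)
    (M : ℕ) (x : Fin M → (Fin (m 0) → ℝ)) (Y : Fin (m D) → Fin M → ℝ)
    (lam : ℝ) (Q : (Fin (m D) → Fin M → ℝ) → ℝ) : Set (Fin (m D) → Fin M → ℝ) :=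
  (fun f => fun k j => f (x j) k) '' RegSolSet σ m D ρ M x Y lam Q



section SignedMeasureDifference

variable {Θ : Type*} [MeasurableSpace Θ]

theorem integrable_of_measurable_of_abs_le {f : Θ → ℝ} (hf : Measurable f) {B : ℝ}
    (hB : ∀ θ, |f θ| ≤ B) (P : Measure Θ) [IsFiniteMeasure P] : Integrable f P :=
  Integrable.of_bound hf.aestronglyMeasurable B (Eventually.of_forall hB)

theorem posPart_add_eq_negPart_add (P N : Measure Θ) [IsFiniteMeasure P] [IsFiniteMeasure N] :
    (P.toSignedMeasure - N.toSignedMeasure).toJordanDecomposition.posPart + N =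
      (P.toSignedMeasure - N.toSignedMeasure).toJordanDecomposition.negPart + P := by
  set μ := P.toSignedMeasure - N.toSignedMeasure with hμ
  have h := μ.toSignedMeasure_toJordanDecomposition
  rw [JordanDecomposition.toSignedMeasure] at h
  rw [← Measure.toSignedMeasure_eq_toSignedMeasure_iff, Measure.toSignedMeasure_add,
    Measure.toSignedMeasure_add]
  rw [sub_eq_iff_eq_add] at h
  rw [h, hμ]
  abel

theorem sInt_toSignedMeasure_sub (P N : Measure Θ) [IsFiniteMeasure P] [IsFiniteMeasure N]
    {f : Θ → ℝ} (hf : Measurable f) {B : ℝ} (hB : ∀ θ, |f θ| ≤ B) :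
    sInt (P.toSignedMeasure - N.toSignedMeasure) f = ∫ θ, f θ ∂P - ∫ θ, f θ ∂N := by
  have hi : ∀ (Q : Measure Θ) (_ : IsFiniteMeasure Q), Integrable f Q := fun Q _ =>
    integrable_of_measurable_of_abs_le hf hB Q
  have h := congrArg (fun Q : Measure Θ => ∫ θ, f θ ∂Q) (posPart_add_eq_negPart_add P N)
  rw [integral_add_measure (hi _ inferInstance) (hi _ inferInstance),
    integral_add_measure (hi _ inferInstance) (hi _ inferInstance)] at h
  rw [sInt]
  linarith

theorem tvNorm_eq_posPart_add_negPart (μ : SignedMeasure Θ) :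
    tvNorm μ = μ.toJordanDecomposition.posPart.real Set.univ +
      μ.toJordanDecomposition.negPart.real Set.univ := by
  rw [tvNorm, SignedMeasure.totalVariation, ← measureReal_def, measureReal_add_apply]

theorem tvNorm_toSignedMeasure_sub_le (P N : Measure Θ) [IsFiniteMeasure P] [IsFiniteMeasure N] :
    tvNorm (P.toSignedMeasure - N.toSignedMeasure) ≤ P.real Set.univ + N.real Set.univ := by
  rw [tvNorm_eq_posPart_add_negPart]
  have h := posPart_add_eq_negPart_add P N
  set j := (P.toSignedMeasure - N.toSignedMeasure).toJordanDecomposition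
  obtain ⟨S, hS, hS1, hS2⟩ := j.mutuallySingular
  have hadd : ∀ A, j.posPart.real A + N.real A = j.negPart.real A + P.real A := fun A => by
    rw [← measureReal_add_apply, ← measureReal_add_apply, h]
  have h1 : j.posPart.real S = 0 := by simp [measureReal_def, hS1]
  have h2 : j.negPart.real Sᶜ = 0 := by simp [measureReal_def, hS2]
  have e := fun (Q : Measure Θ) (_ : IsFiniteMeasure Q) => measureReal_add_measureReal_compl (μ := Q) hS
  have := e j.posPart inferInstance
  have := e j.negPart inferInstance
  have := e P inferInstance
  have := e N inferInstance
  have := hadd S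
  have := hadd Sᶜ
  have : 0 ≤ P.real S := measureReal_nonneg
  have : 0 ≤ N.real Sᶜ := measureReal_nonneg
  linarith [measureReal_nonneg (μ := N) (s := Sᶜ)]

theorem toSignedMeasure_eq_sum_dirac [MeasurableSingletonClass Θ] (P : Measure Θ)
    [IsFiniteMeasure P] (S : Finset Θ) (hS : P (S : Set Θ)ᶜ = 0) :
    P.toSignedMeasure = ∑ s ∈ S, P.real {s} • (Measure.dirac s).toSignedMeasure := by
  ext A hA
  have hev : ∀ T : Finset Θ, (∑ s ∈ T, P.real {s} • (Measure.dirac s).toSignedMeasure) A =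
      ∑ s ∈ T, P.real {s} * (Measure.dirac s).real A := fun T => by
    classical
    induction T using Finset.induction_on with
    | empty => simp
    | insert s T hs ih =>
      rw [Finset.sum_insert hs, Finset.sum_insert hs, add_apply, ih,
        smul_apply, Measure.toSignedMeasure_apply_measurable hA, smul_eq_mul]
  rw [hev, Measure.toSignedMeasure_apply_measurable hA, ← integral_indicator_one hA,
    ← Measure.restrict_eq_self_of_ae_mem (μ := P) (s := (S : Set Θ)) hS,
    setIntegral_finset _ ?_]
  · rw [Measure.restrict_eq_self_of_ae_mem (μ := P) (s := (S : Set Θ)) hS]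
    refine Finset.sum_congr rfl fun s _ => ?_
    rw [smul_eq_mul, measureReal_def (μ := Measure.dirac s), Measure.dirac_apply' _ hA]
    by_cases hs : s ∈ A <;> simp [hs]
  · exact ((integrable_const (1 : ℝ)).indicator hA).integrableOn

end SignedMeasureDifference

section Reweighting

variable {Θ : Type*} [MeasurableSpace Θ]

/-- The measure `(1 + h) P`. -/
def reweight (P : Measure Θ) (h : Θ → ℝ) : Measure Θ :=
  P.withDensity fun θ => ENNReal.ofReal (1 + h θ)

theorem isFiniteMeasure_reweight (P : Measure Θ) [IsFiniteMeasure P] {h : Θ → ℝ}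
    (hh : Measurable h) (hb : ∀ θ, |h θ| ≤ 1) : IsFiniteMeasure (reweight P h) := by
  refine isFiniteMeasure_withDensity_ofReal ?_
  exact ((integrable_const 1).add (integrable_of_measurable_of_abs_le hh hb P)).2

theorem integral_reweight (P : Measure Θ) {h : Θ → ℝ}
    (hh : Measurable h) (hb : ∀ θ, |h θ| ≤ 1) (f : Θ → ℝ) :
    ∫ θ, f θ ∂(reweight P h) = ∫ θ, (1 + h θ) * f θ ∂P := by
  rw [reweight, integral_withDensity_eq_integral_toReal_smul (by fun_prop) (by simp)]
  refine integral_congr_ae (Eventually.of_forall fun θ => ?_)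
  have := (abs_le.mp (hb θ)).1
  simp only [smul_eq_mul]
  rw [ENNReal.toReal_ofReal (by linarith)]

theorem reweight_add_reweight_neg (P : Measure Θ) {h : Θ → ℝ}
    (hh : Measurable h) (hb : ∀ θ, |h θ| ≤ 1) :
    reweight P h + reweight P (fun θ => -h θ) = P + P := by
  rw [reweight, reweight, ← withDensity_add_left (by fun_prop)]
  have : ((fun θ => ENNReal.ofReal (1 + h θ)) + fun θ => ENNReal.ofReal (1 + -h θ)) =
      fun _ => 1 + 1 := by
    funext θ
    have := abs_le.mp (hb θ)
    rw [Pi.add_apply, ← ENNReal.ofReal_add (by linarith) (by linarith)]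
    rw [← ENNReal.ofReal_one, ← ENNReal.ofReal_add zero_le_one zero_le_one]
    ring_nf
  rw [this, withDensity_const, add_smul, one_smul]

theorem sInt_reweight_sub (P N : Measure Θ) [IsFiniteMeasure P] [IsFiniteMeasure N]
    {h : Θ → ℝ} (hh : Measurable h) (hb : ∀ θ, |h θ| ≤ 1)
    [IsFiniteMeasure (reweight P h)] [IsFiniteMeasure (reweight N h)]
    {f : Θ → ℝ} (hf : Measurable f) {B : ℝ} (hB : ∀ θ, |f θ| ≤ B) :
    sInt ((reweight P h).toSignedMeasure - (reweight N h).toSignedMeasure) f =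
      (∫ θ, f θ ∂P - ∫ θ, f θ ∂N) + (∫ θ, h θ * f θ ∂P - ∫ θ, h θ * f θ ∂N) := by
  have hi : ∀ (Q : Measure Θ) (_ : IsFiniteMeasure Q),
      ∫ θ, (1 + h θ) * f θ ∂Q = ∫ θ, f θ ∂Q + ∫ θ, h θ * f θ ∂Q := fun Q _ => by
    have hbd : ∀ θ, |h θ * f θ| ≤ 1 * B := fun θ => by
      rw [abs_mul]
      exact mul_le_mul (hb θ) (hB θ) (abs_nonneg _) zero_le_one
    have hi2 : Integrable (fun θ => h θ * f θ) Q :=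
      integrable_of_measurable_of_abs_le (hh.mul hf) hbd Q
    rw [← integral_add (integrable_of_measurable_of_abs_le hf hB Q) hi2]
    exact integral_congr_ae (Eventually.of_forall fun θ => by ring)
  rw [sInt_toSignedMeasure_sub _ _ hf hB, integral_reweight P hh hb, integral_reweight N hh hb,
    hi P inferInstance, hi N inferInstance]
  ring

end Reweighting

section ZeroAtInfty

variable {Θ : Type*} [TopologicalSpace Θ]

theorem abs_apply_le_norm (g : C₀(Θ, ℝ)) (θ : Θ) : |g θ| ≤ ‖g‖ := by
  simpa using g.toBCF.norm_coe_le_norm θ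

theorem norm_zeroAtInfty_le {g : C₀(Θ, ℝ)} {B : ℝ} (hB : 0 ≤ B) (h : ∀ θ, |g θ| ≤ B) :
    ‖g‖ ≤ B := by
  rw [← ZeroAtInftyContinuousMap.norm_toBCF_eq_norm]
  exact (BoundedContinuousFunction.norm_le hB).mpr h

theorem sum_smul_apply {ι : Type*} [Fintype ι] (K : ι → C₀(Θ, ℝ)) (a : ι → ℝ) (θ : Θ) :
    (∑ i, a i • K i) θ = ∑ i, a i * K i θ := by
  have h := map_sum (⟨⟨fun g : C₀(Θ, ℝ) => g θ, rfl⟩, fun _ _ => rfl⟩ : C₀(Θ, ℝ) →+ ℝ)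
    (fun i => a i • K i) Finset.univ
  exact h

theorem apply_eq_sum_single_mul {ι : Type*} [Fintype ι] [DecidableEq ι] (f : (ι → ℝ) →ₗ[ℝ] ℝ)
    (v : ι → ℝ) : f v = ∑ i, f (Pi.single i 1) * v i := by
  rw [f.pi_apply_eq_sum_univ v]
  refine Finset.sum_congr rfl fun i _ => ?_
  rw [smul_eq_mul, mul_comm]
  congr 2
  ext j
  simp [Pi.single_apply, eq_comm]

theorem sum_mul_le_mul_norm {ι : Type*} [Fintype ι] {K : ι → C₀(Θ, ℝ)} (hLI : LinearIndependent ℝ K) {y : ι → ℝ} {C : ℝ}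
    (hC : ∀ a : ι → ℝ, ‖∑ i, a i • K i‖ = 1 → ∑ i, a i * y i ≤ C) (a : ι → ℝ) :
    ∑ i, a i * y i ≤ C * ‖∑ i, a i • K i‖ := by
  rcases eq_or_ne (∑ i, a i • K i) 0 with h0 | h0
  · have := Fintype.linearIndependent_iff.mp hLI a h0
    simp [this]
  · have hpos : 0 < ‖∑ i, a i • K i‖ := norm_pos_iff.mpr h0
    have h := hC (fun i => ‖∑ i, a i • K i‖⁻¹ * a i) (by
      simp_rw [mul_smul]
      rw [← Finset.smul_sum, norm_smul, norm_inv, norm_norm, inv_mul_cancel₀ hpos.ne'])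
    simp_rw [mul_assoc] at h
    rw [← Finset.mul_sum, inv_mul_le_iff₀ hpos] at h
    linarith

theorem dual_value_pos {ι : Type*} [Fintype ι] {K : ι → C₀(Θ, ℝ)} (hLI : LinearIndependent ℝ K) {y : ι → ℝ}
    (hy : y ≠ 0) {C : ℝ} (hC : ∀ a : ι → ℝ, ‖∑ i, a i • K i‖ = 1 → ∑ i, a i * y i ≤ C) :
    0 < C := by
  have h := sum_mul_le_mul_norm hLI hC y
  obtain ⟨i, hi⟩ := Function.ne_iff.mp hy
  have hpos : 0 < ∑ i, y i * y i :=
    Finset.sum_pos' (fun j _ => mul_self_nonneg _) ⟨i, Finset.mem_univ _, mul_self_pos.mpr hi⟩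
  exact pos_of_mul_pos_left (hpos.trans_le h) (norm_nonneg _)

end ZeroAtInfty

section RepresenterTheorem

variable {Θ : Type*} [TopologicalSpace Θ] [MeasurableSpace Θ] [BorelSpace Θ] {ι : Type*}

theorem measurable_zeroAtInfty (g : C₀(Θ, ℝ)) : Measurable g :=
  g.continuous.measurable

theorem integrable_zeroAtInfty (g : C₀(Θ, ℝ)) (P : Measure Θ) [IsFiniteMeasure P] :
    Integrable (fun θ => g θ) P :=
  integrable_of_measurable_of_abs_le (measurable_zeroAtInfty g) (abs_apply_le_norm g) P

/-- The vectors of moments `∫ K i dP - ∫ K i dN` of signed measures of total variation at most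
`C`. -/
def momentBall (K : ι → C₀(Θ, ℝ)) (C : ℝ) : Set (ι → ℝ) :=
  {z | ∃ P N : Measure Θ, ∃ (_ : IsFiniteMeasure P) (_ : IsFiniteMeasure N),
    P.real Set.univ + N.real Set.univ ≤ C ∧ ∀ i, ∫ θ, K i θ ∂P - ∫ θ, K i θ ∂N = z i}

theorem convex_momentBall (K : ι → C₀(Θ, ℝ)) (C : ℝ) : Convex ℝ (momentBall K C) := by
  rintro z ⟨P, N, _, _, hC, hz⟩ z' ⟨P', N', _, _, hC', hz'⟩ a b ha hb hab
  refine ⟨a.toNNReal • P + b.toNNReal • P', a.toNNReal • N + b.toNNReal • N',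
    inferInstance, inferInstance, ?_, fun i => ?_⟩
  · rw [measureReal_add_apply, measureReal_add_apply]
    simp only [measureReal_nnreal_smul_apply, Real.coe_toNNReal _ ha, Real.coe_toNNReal _ hb]
    calc _ = a * (P.real Set.univ + N.real Set.univ) +
          b * (P'.real Set.univ + N'.real Set.univ) := by ring
      _ ≤ a * C + b * C := by gcongr
      _ = C := by rw [← add_mul, hab, one_mul]
  · have hi := fun (Q : Measure Θ) (_ : IsFiniteMeasure Q) => integrable_zeroAtInfty (K i) Q
    rw [integral_add_measure (hi _ inferInstance) (hi _ inferInstance),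
      integral_add_measure (hi _ inferInstance) (hi _ inferInstance)]
    simp only [integral_smul_nnreal_measure, NNReal.smul_def, Real.coe_toNNReal _ ha,
      Real.coe_toNNReal _ hb, Pi.add_apply, Pi.smul_apply, ← hz i, ← hz' i, smul_eq_mul]
    ring

omit [BorelSpace Θ] in
theorem zero_mem_momentBall (K : ι → C₀(Θ, ℝ)) {C : ℝ} (hC : 0 ≤ C) :
    (0 : ι → ℝ) ∈ momentBall K C :=
  ⟨0, 0, inferInstance, inferInstance, by simpa using hC, by simp⟩

theorem smul_apply_mem_momentBall (K : ι → C₀(Θ, ℝ)) {C : ℝ} (hC : 0 ≤ C) (θ : Θ) :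
    (fun i => C * K i θ) ∈ momentBall K C := by
  refine ⟨C.toNNReal • Measure.dirac θ, 0, inferInstance, inferInstance, ?_, fun i => ?_⟩
  · simp [measureReal_nnreal_smul_apply, hC]
  · rw [integral_smul_nnreal_measure, integral_dirac' (fun x => K i x) θ (measurable_zeroAtInfty (K i)).stronglyMeasurable]
    simp [NNReal.smul_def, hC]

theorem neg_smul_apply_mem_momentBall (K : ι → C₀(Θ, ℝ)) {C : ℝ} (hC : 0 ≤ C) (θ : Θ) :
    (fun i => -(C * K i θ)) ∈ momentBall K C := by
  refine ⟨0, C.toNNReal • Measure.dirac θ, inferInstance, inferInstance, ?_, fun i => ?_⟩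
  · simp [measureReal_nnreal_smul_apply, hC]
  · rw [integral_smul_nnreal_measure, integral_dirac' (fun x => K i x) θ (measurable_zeroAtInfty (K i)).stronglyMeasurable]
    simp [NNReal.smul_def, hC]

variable [Fintype ι]

theorem interior_momentBall_nonempty {K : ι → C₀(Θ, ℝ)} (hLI : LinearIndependent ℝ K)
    {C : ℝ} (hC : 0 < C) : (interior (momentBall K C)).Nonempty := by
  classical
  rw [(convex_momentBall K C).interior_nonempty_iff_affineSpan_eq_top,
    ← Set.insert_eq_of_mem (zero_mem_momentBall K hC.le)]
  refine SetLike.coe_injective ?_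
  rw [affineSpan_insert_zero]
  by_contra hne
  have hlt : Submodule.span ℝ (momentBall K C) < ⊤ :=
    lt_top_iff_ne_top.mpr fun h => hne (by rw [h]; rfl)
  obtain ⟨f, hf, hker⟩ := Submodule.exists_le_ker_of_lt_top _ hlt
  apply hf
  have hrep := apply_eq_sum_single_mul f
  have hsum : ∑ i, f (Pi.single i 1) • K i = 0 := by
    ext θ
    rw [sum_smul_apply]
    have h0 : f (fun i => C * K i θ) = 0 :=
      hker (Submodule.subset_span (smul_apply_mem_momentBall K hC.le θ))
    rw [hrep] at h0
    have : C * ∑ i, f (Pi.single i 1) * K i θ = 0 := by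
      rw [← h0, Finset.mul_sum]
      exact Finset.sum_congr rfl fun i _ => by ring
    simpa [hC.ne'] using this
  have hz := Fintype.linearIndependent_iff.mp hLI _ hsum
  ext i
  simpa using hz i

theorem mem_momentBall_of_dual_lt {K : ι → C₀(Θ, ℝ)} (hLI : LinearIndependent ℝ K)
    {y : ι → ℝ} {C : ℝ} (hC : 0 < C)
    (hy : ∀ a : ι → ℝ, a ≠ 0 → ∑ i, a i * y i < C * ‖∑ i, a i • K i‖) :
    y ∈ momentBall K C := by
  classical
  by_contra hmem
  obtain ⟨f, hf, hle⟩ := geometric_hahn_banach_of_nonempty_interior_point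
    (convex_momentBall K C) (fun h => hmem (interior_subset h))
    (interior_momentBall_nonempty hLI hC)
  set a : ι → ℝ := fun i => f (Pi.single i 1) with ha
  have hrep : ∀ v : ι → ℝ, f v = ∑ i, a i * v i :=
    apply_eq_sum_single_mul (f : (ι → ℝ) →ₗ[ℝ] ℝ)
  have ha0 : a ≠ 0 := fun h => hf (ContinuousLinearMap.ext fun v => by simp [hrep, h])
  have hlt := hy a ha0
  rw [← hrep] at hlt
  refine hlt.not_ge ?_
  have hfy : 0 ≤ f y := by simpa using hle 0 (zero_mem_momentBall K hC.le)
  rw [mul_comm, ← le_div_iff₀ hC]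
  refine norm_zeroAtInfty_le (by positivity) fun θ => ?_
  have key : f (fun i => C * K i θ) = C * (∑ i, a i • K i) θ := by
    rw [hrep, sum_smul_apply, Finset.mul_sum]
    exact Finset.sum_congr rfl fun i _ => by ring
  have h1 := hle _ (smul_apply_mem_momentBall K hC.le θ)
  have h2 := hle _ (neg_smul_apply_mem_momentBall K hC.le θ)
  rw [show (fun i => -(C * K i θ)) = -(fun i => C * K i θ) from rfl, map_neg] at h2
  rw [key] at h1 h2
  rw [le_div_iff₀ hC]
  rcases abs_cases ((∑ i, a i • K i) θ) with ⟨h, -⟩ | ⟨h, -⟩ <;> rw [h] <;> linarith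

/-- The signed measures of minimal total variation among those with moments `y`. -/
def minNormSet (K : ι → C₀(Θ, ℝ)) (y : ι → ℝ) : Set (SignedMeasure Θ) :=
  {μ | (∀ i, sInt μ (K i) = y i) ∧
    ∀ ν : SignedMeasure Θ, (∀ i, sInt ν (K i) = y i) → tvNorm μ ≤ tvNorm ν}

theorem tvNorm_le_dual_value {K : ι → C₀(Θ, ℝ)} (hLI : LinearIndependent ℝ K) {y : ι → ℝ}
    (hy : y ≠ 0) {C : ℝ} (hC : ∀ a : ι → ℝ, ‖∑ i, a i • K i‖ = 1 → ∑ i, a i * y i ≤ C)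
    {μ : SignedMeasure Θ} (hμ : μ ∈ minNormSet K y) : tvNorm μ ≤ C := by
  refine le_of_forall_gt_imp_ge_of_dense fun B hB => ?_
  have hCpos := dual_value_pos hLI hy hC
  obtain ⟨P, N, _, _, hPN, hz⟩ := mem_momentBall_of_dual_lt hLI (hCpos.trans hB) (y := y)
    fun a ha => (sum_mul_le_mul_norm hLI hC a).trans_lt <| by
      have : 0 < ‖∑ i, a i • K i‖ := norm_pos_iff.mpr fun h0 =>
        ha (funext (Fintype.linearIndependent_iff.mp hLI a h0))
      gcongr
  refine (hμ.2 (P.toSignedMeasure - N.toSignedMeasure) fun i => ?_).trans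
    ((tvNorm_toSignedMeasure_sub_le P N).trans hPN)
  rw [← hz i]
  exact sInt_toSignedMeasure_sub P N (measurable_zeroAtInfty (K i)) (abs_apply_le_norm _)

omit [TopologicalSpace Θ] [BorelSpace Θ] in
theorem ae_eq_one_and_ae_eq_neg_one {P N : Measure Θ} [IsFiniteMeasure P] [IsFiniteMeasure N]
    {g : Θ → ℝ} (hg : Measurable g) (hb : ∀ θ, |g θ| ≤ 1)
    (h : P.real Set.univ + N.real Set.univ ≤ ∫ θ, g θ ∂P - ∫ θ, g θ ∂N) :
    (∀ᵐ θ ∂P, g θ = 1) ∧ ∀ᵐ θ ∂N, g θ = -1 := by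
  have hiP := integrable_of_measurable_of_abs_le hg hb P
  have hiN := integrable_of_measurable_of_abs_le hg hb N
  have eP : ∫ θ, (1 - g θ) ∂P = P.real Set.univ - ∫ θ, g θ ∂P := by
    rw [integral_sub (integrable_const _) hiP]; simp
  have eN : ∫ θ, (1 + g θ) ∂N = N.real Set.univ + ∫ θ, g θ ∂N := by
    rw [integral_add (integrable_const _) hiN]; simp
  have hP0 : 0 ≤ fun θ => 1 - g θ := fun θ => by
    have := (abs_le.mp (hb θ)).2
    simp only [Pi.zero_apply]; linarith
  have hN0 : 0 ≤ fun θ => 1 + g θ := fun θ => by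
    have := (abs_le.mp (hb θ)).1
    simp only [Pi.zero_apply]; linarith
  have pP := integral_nonneg (μ := P) hP0
  have pN := integral_nonneg (μ := N) hN0
  have zP := (integral_eq_zero_iff_of_nonneg hP0 ((integrable_const _).sub hiP)).mp
    (show ∫ θ, (1 - g θ) ∂P = 0 by linarith)
  have zN := (integral_eq_zero_iff_of_nonneg hN0 ((integrable_const _).add hiN)).mp
    (show ∫ θ, (1 + g θ) ∂N = 0 by linarith)
  constructor
  · filter_upwards [zP] with θ hθ
    simp only [Pi.zero_apply] at hθ
    linarith
  · filter_upwards [zN] with θ hθ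
    simp only [Pi.zero_apply] at hθ
    linarith

omit [Fintype ι] in
theorem ae_eq_zero_of_extreme {K : ι → C₀(Θ, ℝ)} {y : ι → ℝ}
    {P N : Measure Θ} [IsFiniteMeasure P] [IsFiniteMeasure N]
    (hext : P.toSignedMeasure - N.toSignedMeasure ∈ (minNormSet K y).extremePoints ℝ)
    (htv : tvNorm (P.toSignedMeasure - N.toSignedMeasure) = P.real Set.univ + N.real Set.univ)
    {g : Θ → ℝ} (hg : Measurable g) (hgb : ∀ θ, |g θ| ≤ 1)
    (hgP : ∀ᵐ θ ∂P, g θ = 1) (hgN : ∀ᵐ θ ∂N, g θ = -1)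
    {h : Θ → ℝ} (hh : Measurable h) (hb : ∀ θ, |h θ| ≤ 1)
    (hK : ∀ i, ∫ θ, h θ * K i θ ∂P = ∫ θ, h θ * K i θ ∂N)
    (hg0 : ∫ θ, h θ * g θ ∂P = ∫ θ, h θ * g θ ∂N) :
    ∀ᵐ θ ∂(P + N), h θ = 0 := by
  have hPg : ∀ u : Θ → ℝ, ∫ θ, u θ * g θ ∂P = ∫ θ, u θ ∂P := fun u =>
    integral_congr_ae (by filter_upwards [hgP] with θ hθ; simp [hθ])
  have hNg : ∀ u : Θ → ℝ, ∫ θ, u θ * g θ ∂N = -∫ θ, u θ ∂N := fun u => by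
    rw [← integral_neg]
    exact integral_congr_ae (by filter_upwards [hgN] with θ hθ; simp [hθ])
  have hmem : ∀ u : Θ → ℝ, Measurable u → (∀ θ, |u θ| ≤ 1) →
      (∀ i, ∫ θ, u θ * K i θ ∂P = ∫ θ, u θ * K i θ ∂N) →
      (∫ θ, u θ ∂P + ∫ θ, u θ ∂N = 0) →
      ∀ (_ : IsFiniteMeasure (reweight P u)) (_ : IsFiniteMeasure (reweight N u)),
      (reweight P u).toSignedMeasure - (reweight N u).toSignedMeasure ∈ minNormSet K y := by
    intro u hu hub huK hu0 _ _
    refine ⟨fun i => ?_, fun ν hν => le_trans ?_ (hext.1.2 ν hν)⟩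
    · rw [← hext.1.1 i, sInt_reweight_sub P N hu hub (measurable_zeroAtInfty (K i))
        (abs_apply_le_norm _), sInt_toSignedMeasure_sub P N (measurable_zeroAtInfty (K i))
        (abs_apply_le_norm _), huK i, sub_self, add_zero]
    · refine (tvNorm_toSignedMeasure_sub_le _ _).trans ?_
      have hmass : ∀ (Q : Measure Θ) (_ : IsFiniteMeasure Q),
          (reweight Q u).real Set.univ = Q.real Set.univ + ∫ θ, u θ ∂Q := fun Q _ => by
        have := integral_reweight Q hu hub fun _ => 1
        simp only [mul_one] at this
        rw [integral_add (integrable_const _) (integrable_of_measurable_of_abs_le hu hub Q)] at this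
        simpa using this
      rw [hmass P inferInstance, hmass N inferInstance, htv]
      linarith
  have hsum : ∫ θ, h θ ∂P + ∫ θ, h θ ∂N = 0 := by
    rw [hPg, hNg] at hg0
    linarith
  have hnb : ∀ θ, |-h θ| ≤ 1 := fun θ => by rw [abs_neg]; exact hb θ
  have iP := isFiniteMeasure_reweight P hh hb
  have iN := isFiniteMeasure_reweight N hh hb
  have iP' := isFiniteMeasure_reweight P hh.neg hnb
  have iN' := isFiniteMeasure_reweight N hh.neg hnb
  have h1 := hmem h hh hb hK hsum iP iN
  have h2 := hmem (fun θ => -h θ) hh.neg hnb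
    (fun i => by simp only [neg_mul, integral_neg, hK i])
    (by rw [integral_neg, integral_neg]; linarith) iP' iN'
  have hseg : P.toSignedMeasure - N.toSignedMeasure ∈ openSegment ℝ
      ((reweight P h).toSignedMeasure - (reweight N h).toSignedMeasure)
      ((reweight P fun θ => -h θ).toSignedMeasure -
        (reweight N fun θ => -h θ).toSignedMeasure) := by
    refine ⟨1 / 2, 1 / 2, by norm_num, by norm_num, by norm_num, ?_⟩
    have hadd : ∀ (Q : Measure Θ) (_ : IsFiniteMeasure Q)
        (_ : IsFiniteMeasure (reweight Q h)) (_ : IsFiniteMeasure (reweight Q fun θ => -h θ)),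
        (reweight Q h).toSignedMeasure + (reweight Q fun θ => -h θ).toSignedMeasure =
          (2 : ℝ) • Q.toSignedMeasure := fun Q _ _ _ => by
      rw [← Measure.toSignedMeasure_add,
        Measure.toSignedMeasure_congr (reweight_add_reweight_neg Q hh hb),
        Measure.toSignedMeasure_add, two_smul]
    rw [← smul_add, sub_add_sub_comm, hadd P inferInstance iP iP', hadd N inferInstance iN iN',
      smul_sub, smul_smul, smul_smul]
    norm_num
  have heq := hext.2 h1 h2 hseg
  have hhg : ∀ θ, |h θ * g θ| ≤ 1 := fun θ => by
    rw [abs_mul]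
    exact mul_le_one₀ (hb θ) (abs_nonneg _) (hgb θ)
  have hhgm : Measurable fun θ => h θ * g θ := hh.mul hg
  have htest := sInt_reweight_sub P N hh hb hhgm hhg
  rw [heq, sInt_toSignedMeasure_sub P N hhgm hhg] at htest
  simp_rw [← mul_assoc] at htest
  rw [hPg (fun θ => h θ * h θ), hNg (fun θ => h θ * h θ)] at htest
  have hsq0 : (0 : Θ → ℝ) ≤ fun θ => h θ * h θ := fun θ => mul_self_nonneg _
  have hsqi : ∀ (Q : Measure Θ) (_ : IsFiniteMeasure Q), Integrable (fun θ => h θ * h θ) Q :=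
    fun Q _ => integrable_of_measurable_of_abs_le (B := 1) (hh.mul hh)
      (fun θ => by rw [Pi.mul_apply, abs_mul]; exact mul_le_one₀ (hb θ) (abs_nonneg _) (hb θ)) Q
  have hz : ∫ θ, h θ * h θ ∂(P + N) = 0 := by
    rw [integral_add_measure (hsqi P inferInstance) (hsqi N inferInstance)]
    linarith
  filter_upwards [(integral_eq_zero_iff_of_nonneg hsq0 (hsqi _ inferInstance)).mp hz] with θ hθ
  exact mul_self_eq_zero.mp hθ

theorem card_le_of_subset_support [T2Space Θ] {K : ι → C₀(Θ, ℝ)} {y : ι → ℝ}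
    {P N : Measure Θ} [IsFiniteMeasure P] [IsFiniteMeasure N]
    (hext : P.toSignedMeasure - N.toSignedMeasure ∈ (minNormSet K y).extremePoints ℝ)
    (htv : tvNorm (P.toSignedMeasure - N.toSignedMeasure) = P.real Set.univ + N.real Set.univ)
    (c : ι → ℝ) (hgb : ∀ θ, |(∑ i, c i • K i) θ| ≤ 1)
    (hgP : ∀ᵐ θ ∂P, (∑ i, c i • K i) θ = 1) (hgN : ∀ᵐ θ ∂N, (∑ i, c i • K i) θ = -1)
    (S : Finset Θ) (hS : (S : Set Θ) ⊆ (P + N).support) : S.card ≤ Fintype.card ι := by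
  classical
  obtain ⟨U, hU, hdisj⟩ := S.finite_toSet.t2_separation
  let v : S → ι → ℝ := fun s i => ∫ θ in U s, K i θ ∂P - ∫ θ in U s, K i θ ∂N
  suffices hv : LinearIndependent ℝ v by
    simpa using hv.fintype_card_le_finrank
  refine Fintype.linearIndependent_iff.mpr fun a ha => ?_
  set b : ℝ := 1 + ∑ s, |a s| with hbdef
  have hb0 : 0 < b := by positivity
  let h : Θ → ℝ := fun θ => ∑ s, (a s / b) * (U s).indicator (fun _ => 1) θ
  have hUm : ∀ s : S, MeasurableSet (U s) := fun s => (hU s).2.measurableSet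
  have hh : Measurable h := by
    refine Finset.measurable_sum _ fun s _ => ?_
    exact (measurable_const.indicator (hUm s)).const_mul _
  have hb : ∀ θ, |h θ| ≤ 1 := fun θ => by
    calc |h θ| ≤ ∑ s, |(a s / b) * (U s).indicator (fun _ => 1) θ| :=
          Finset.abs_sum_le_sum_abs _ _
      _ ≤ ∑ s, |a s| / b := by
          refine Finset.sum_le_sum fun s _ => ?_
          rw [abs_mul, abs_div, abs_of_pos hb0]
          refine mul_le_of_le_one_right (by positivity) ?_
          by_cases hθ : θ ∈ U s <;> simp [hθ]
      _ = (∑ s, |a s|) / b := by rw [Finset.sum_div]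
      _ ≤ 1 := by rw [div_le_one hb0]; linarith
  have hint : ∀ (Q : Measure Θ) (_ : IsFiniteMeasure Q) (f : C₀(Θ, ℝ)),
      ∫ θ, h θ * f θ ∂Q = ∑ s, (a s / b) * ∫ θ in U s, f θ ∂Q := fun Q _ f => by
    have e : ∀ θ, h θ * f θ = ∑ s, (a s / b) * (U s).indicator (fun θ => f θ) θ := fun θ => by
      rw [Finset.sum_mul]
      refine Finset.sum_congr rfl fun s _ => ?_
      by_cases hθ : θ ∈ U s <;> simp [hθ]
    simp_rw [e]
    rw [integral_finsetSum _ fun s _ =>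
      ((integrable_zeroAtInfty f Q).indicator (hUm s)).const_mul _]
    refine Finset.sum_congr rfl fun s _ => ?_
    rw [integral_const_mul, integral_indicator (hUm s)]
  have hK : ∀ i, ∫ θ, h θ * K i θ ∂P = ∫ θ, h θ * K i θ ∂N := fun i => by
    rw [hint P inferInstance, hint N inferInstance, ← sub_eq_zero, ← Finset.sum_sub_distrib]
    have hi := congrFun ha i
    simp only [Finset.sum_apply, Pi.smul_apply, Pi.zero_apply, smul_eq_mul, v] at hi
    calc _ = (∑ s, a s * (∫ θ in U s, K i θ ∂P - ∫ θ in U s, K i θ ∂N)) / b := by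
          rw [Finset.sum_div]
          exact Finset.sum_congr rfl fun s _ => by ring
      _ = 0 := by rw [hi, zero_div]
  have hg0 : ∫ θ, h θ * (∑ i, c i • K i) θ ∂P = ∫ θ, h θ * (∑ i, c i • K i) θ ∂N := by
    have e : ∀ (Q : Measure Θ) (_ : IsFiniteMeasure Q),
        ∫ θ, h θ * (∑ i, c i • K i) θ ∂Q = ∑ i, c i * ∫ θ, h θ * K i θ ∂Q := fun Q _ => by
      simp_rw [sum_smul_apply, Finset.mul_sum, mul_left_comm]
      rw [integral_finsetSum]
      · simp_rw [integral_const_mul]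
      · intro i _
        refine Integrable.const_mul ?_ _
        refine integrable_of_measurable_of_abs_le (B := 1 * ‖K i‖)
          (hh.mul (measurable_zeroAtInfty (K i))) (fun θ => ?_) Q
        rw [Pi.mul_apply, abs_mul]
        exact mul_le_mul (hb θ) (abs_apply_le_norm _ _) (abs_nonneg _) zero_le_one
    rw [e P inferInstance, e N inferInstance]
    simp_rw [hK]
  have hz := ae_eq_zero_of_extreme hext htv (measurable_zeroAtInfty (∑ i, c i • K i)) hgb hgP hgN
    hh hb hK hg0
  intro s
  by_contra hs
  have hpos := (Measure.mem_support_iff_forall (μ := P + N) s.1).mp (hS s.2) (U s)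
    ((hU s).2.mem_nhds (hU s).1)
  refine hpos.ne' (measure_mono_null (fun θ hθ => ?_) hz)
  have : h θ = a s / b := by
    refine (Finset.sum_eq_single s (fun s' _ hne => ?_) (by simp)).trans (by simp [hθ])
    have hnot : θ ∉ U s' := fun hθ' =>
      Set.disjoint_left.mp (hdisj s'.2 s.2 (fun h => hne (Subtype.ext h))) hθ' hθ
    simp [hnot]
  simp only [Set.mem_compl_iff, Set.mem_ofPred_eq, this]
  exact div_ne_zero hs hb0.ne'

theorem exists_dirac_representation [T2Space Θ] [HereditarilyLindelofSpace Θ] {K : ι → C₀(Θ, ℝ)}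
    (hLI : LinearIndependent ℝ K) {y : ι → ℝ} (hy : y ≠ 0) (c : ι → ℝ)
    (hc : ‖∑ i, c i • K i‖ = 1)
    (hopt : ∀ a : ι → ℝ, ‖∑ i, a i • K i‖ = 1 → ∑ i, a i * y i ≤ ∑ i, c i * y i)
    {μ : SignedMeasure Θ} (hμ : μ ∈ (minNormSet K y).extremePoints ℝ) :
    ∃ (S : Finset Θ) (γ : Θ → ℝ), S.Nonempty ∧ S.card ≤ Fintype.card ι ∧
      (∀ s ∈ S, |(∑ i, c i • K i) s| = 1) ∧ ∑ s ∈ S, γ s = ∑ i, c i * y i ∧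
      μ = ∑ s ∈ S, (γ s * (∑ i, c i • K i) s) • (Measure.dirac s).toSignedMeasure := by
  classical
  set g := ∑ i, c i • K i with hg
  have htvle := tvNorm_le_dual_value hLI hy hopt hμ.1
  have hCpos := dual_value_pos hLI hy hopt
  set P := μ.toJordanDecomposition.posPart with hP
  set N := μ.toJordanDecomposition.negPart with hN
  have hμPN : μ = P.toSignedMeasure - N.toSignedMeasure :=
    μ.toSignedMeasure_toJordanDecomposition.symm
  have htv : tvNorm μ = P.real Set.univ + N.real Set.univ := tvNorm_eq_posPart_add_negPart μ
  have hgb : ∀ θ, |g θ| ≤ 1 := fun θ => hc ▸ abs_apply_le_norm g θ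
  have hgint : ∫ θ, g θ ∂P - ∫ θ, g θ ∂N = ∑ i, c i * y i := by
    have e : ∀ (Q : Measure Θ) (_ : IsFiniteMeasure Q),
        ∫ θ, g θ ∂Q = ∑ i, c i * ∫ θ, K i θ ∂Q := fun Q _ => by
      simp_rw [hg, sum_smul_apply]
      rw [integral_finsetSum _ fun i _ => (integrable_zeroAtInfty (K i) Q).const_mul _]
      simp_rw [integral_const_mul]
    rw [e P inferInstance, e N inferInstance, ← Finset.sum_sub_distrib]
    refine Finset.sum_congr rfl fun i _ => ?_
    rw [← hμ.1.1 i, sInt, mul_sub]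
  obtain ⟨hgP, hgN⟩ := ae_eq_one_and_ae_eq_neg_one (measurable_zeroAtInfty g) hgb
    (by rw [hgint, ← htv]; exact htvle)
  have hiP : ∫ θ, g θ ∂P = P.real Set.univ := by
    rw [integral_congr_ae (g := fun _ => (1 : ℝ)) hgP]; simp
  have hiN : ∫ θ, g θ ∂N = -N.real Set.univ := by
    rw [integral_congr_ae (g := fun _ => (-1 : ℝ)) hgN]; simp
  have hmass : P.real Set.univ + N.real Set.univ = ∑ i, c i * y i := by
    rw [← hgint, hiP, hiN, sub_neg_eq_add]
  have hcard : ∀ S : Finset Θ, (S : Set Θ) ⊆ (P + N).support → S.card ≤ Fintype.card ι :=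
    fun S hS => card_le_of_subset_support (hμPN ▸ hμ) (hμPN ▸ htv) c hgb hgP hgN S hS
  have hfin : (P + N).support.Finite := by
    by_contra hinf
    obtain ⟨S, hS, hScard⟩ := Set.Infinite.exists_subset_card_eq hinf (Fintype.card ι + 1)
    have := hcard S hS
    omega
  obtain ⟨S, hS⟩ := hfin.exists_finset_coe
  have hSnull : (P + N) (S : Set Θ)ᶜ = 0 := by rw [hS]; exact Measure.measure_compl_support
  rw [Measure.add_apply, add_eq_zero] at hSnull
  have hgS : ∀ s ∈ S, |g s| = 1 := by
    have hclosed : IsClosed {θ | |g θ| = 1} :=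
      isClosed_eq (continuous_abs.comp g.continuous) continuous_const
    have hae : ∀ᵐ θ ∂(P + N), |g θ| = 1 := by
      rw [ae_add_measure_iff]
      exact ⟨by filter_upwards [hgP] with θ h; simp [h], by filter_upwards [hgN] with θ h; simp [h]⟩
    intro s hs
    exact Measure.support_subset_of_isClosed hclosed hae (hS ▸ Finset.mem_coe.mpr hs)
  have hrP := toSignedMeasure_eq_sum_dirac P S hSnull.1
  have hrN := toSignedMeasure_eq_sum_dirac N S hSnull.2
  have hsum : ∀ (Q : Measure Θ) (_ : IsFiniteMeasure Q), Q (S : Set Θ)ᶜ = 0 →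
      ∑ s ∈ S, Q.real {s} = Q.real Set.univ := fun Q _ hQ => by
    rw [sum_measureReal_singleton, ← measureReal_add_measureReal_compl (μ := Q) S.measurableSet,
      measureReal_def (s := (S : Set Θ)ᶜ), hQ]
    simp
  have htotal : ∑ s ∈ S, (P.real {s} + N.real {s}) = ∑ i, c i * y i := by
    rw [Finset.sum_add_distrib, hsum P inferInstance hSnull.1, hsum N inferInstance hSnull.2, hmass]
  refine ⟨S, fun s => P.real {s} + N.real {s}, ?_, hcard S hS.subset, hgS, htotal, ?_⟩
  · rw [Finset.nonempty_iff_ne_empty]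
    rintro rfl
    rw [Finset.sum_empty] at htotal
    exact hCpos.ne htotal
  · rw [hμPN, hrP, hrN, ← Finset.sum_sub_distrib]
    refine Finset.sum_congr rfl fun s hs => ?_
    refine (sub_smul _ _ _).symm.trans ?_
    congr 1
    rcases eq_or_eq_neg_of_abs_eq (hgS s hs) with h | h
    · have : N {s} = 0 := measure_mono_null
        (fun θ (hθ : θ = s) => show ¬ g θ = -1 by rw [hθ, h]; norm_num) hgN
      simp [h, measureReal_def, this]
    · have : P {s} = 0 := measure_mono_null
        (fun θ (hθ : θ = s) => show ¬ g θ = 1 by rw [hθ, h]; norm_num) hgP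
      simp [h, measureReal_def, this]

end RepresenterTheorem

theorem exists_fin_indexing {α E : Type*} [AddCommMonoid E] [Module ℝ E] (S : Finset α)
    (hS : S.Nonempty) {n : ℕ} (hn : S.card ≤ n) (γ : α → ℝ) :
    ∃ (w : Fin n → ℝ) (p : Fin n → α), (∀ ℓ, p ℓ ∈ S) ∧ ∑ ℓ, w ℓ = ∑ s ∈ S, γ s ∧
      ∀ (u : α → ℝ) (F : α → E), ∑ ℓ, (w ℓ * u (p ℓ)) • F (p ℓ) = ∑ s ∈ S, (γ s * u s) • F s := by
  obtain ⟨s₀, hs₀⟩ := hS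
  let e : S → Fin n := fun s => Fin.castLE hn (S.equivFin s)
  have he : Function.Injective e := (Fin.castLE_injective hn).comp S.equivFin.injective
  let w := Function.extend e (fun s => γ s) 0
  let p := Function.extend e (fun s => (s : α)) fun _ => s₀
  have hw : ∀ s, w (e s) = γ s := fun s => he.extend_apply _ _ s
  have hp : ∀ s, p (e s) = s := fun s => he.extend_apply _ _ s
  have hw0 : ∀ ℓ, ℓ ∉ Set.range e → w ℓ = 0 := fun ℓ hℓ => Function.extend_apply' _ _ _ hℓ
  refine ⟨w, p, fun ℓ => ?_, ?_, fun u F => ?_⟩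
  · by_cases hℓ : ℓ ∈ Set.range e
    · obtain ⟨s, rfl⟩ := hℓ
      rw [hp]
      exact s.2
    · rwa [show p ℓ = s₀ from Function.extend_apply' _ _ _ hℓ]
  · rw [← Finset.sum_coe_sort S]
    exact (Fintype.sum_of_injective e he _ _ hw0 fun s => (hw s).symm).symm
  · rw [← Finset.sum_coe_sort S]
    refine (Fintype.sum_of_injective e he _ _ (fun ℓ hℓ => ?_) fun s => ?_).symm
    · rw [hw0 ℓ hℓ, zero_mul, zero_smul]
    · rw [hw, hp]

/-- Let `ĉ` solve the dual problem, `C*` its optimal value,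
`ĝ := C*·∑_{k,j} ĉ_{kj} K_k(x_j,·)`.  Every extreme point `μ̂` of the solution set of
the measure MNI problem is of the form
`μ̂ = ∑_{ℓ=1}^{tm} γ_ℓ sign(ĝ(θ_ℓ)) δ_{θ_ℓ}` with `∑ γ_ℓ = ‖ĝ‖_∞` and
`θ_ℓ ∈ Θ(ĝ) = {θ : |ĝ(θ)| = ‖ĝ‖_∞}`. -/
theorem statement_15
    (σ : ℝ → ℝ) (hσ : Continuous σ) (m : ℕ → ℕ) (D : ℕ) (hD : 0 < D)
    (ρ : Params m D → ℝ) (hρc : Continuous ρ) (hρpos : ∀ θ, 0 < ρ θ)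
    (Kb : (Fin (m 0) → ℝ) → Fin (m D) → C₀(Params m D, ℝ))
    (hKb : ∀ x k θ, Kb x k θ = NNet σ m D θ x k * ρ θ)
    (M : ℕ) (x : Fin M → (Fin (m 0) → ℝ)) (hx : Function.Injective x)
    (Y : Fin (m D) → Fin M → ℝ) (hY : Y ≠ 0)
    (hLI : LinearIndependent ℝ (fun p : Fin (m D) × Fin M => Kb (x p.2) p.1))
    (c : Fin (m D) → Fin M → ℝ) (hc : dualSolves m D Kb M x Y c) :
    ∀ μhat ∈ Set.extremePoints ℝ (MeasSolSet σ m D ρ M x Y),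
      ∃ (γ : Fin (m D * M) → ℝ) (θs : Fin (m D * M) → Params m D),
        (∑ ℓ, γ ℓ) = ‖ghat m D Kb M x Y c‖
        ∧ (∀ ℓ, θs ℓ ∈ ThetaSet m D (ghat m D Kb M x Y c))
        ∧ μhat = ∑ ℓ, (γ ℓ * Real.sign (ghat m D Kb M x Y c (θs ℓ))) •
            (MeasureTheory.Measure.dirac (θs ℓ)).toSignedMeasure := by
  intro μhat hμ
  have hKb' : ∀ z k, (fun θ => NNet σ m D θ z k * ρ θ) = Kb z k := fun z k =>
    funext fun θ => (hKb z k θ).symm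
  have hset : MeasSolSet σ m D ρ M x Y =
      minNormSet (fun p : Fin (m D) × Fin M => Kb (x p.2) p.1) (fun p => Y p.1 p.2) := by
    have hiff : ∀ ν : SignedMeasure (Params m D), interpolates m D M x Y (fMu σ m D ρ ν) ↔
        ∀ p : Fin (m D) × Fin M, sInt ν (Kb (x p.2) p.1) = Y p.1 p.2 := fun ν => by
      simp only [interpolates, fMu, hKb', Prod.forall]
      exact forall_comm
    ext ν
    simp only [MeasSolSet, minNormSet, Set.mem_ofPred_eq, hiff]
  have hG : ∀ a : Fin (m D) → Fin M → ℝ, ∑ k, ∑ j, a k j • Kb (x j) k =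
      ∑ p : Fin (m D) × Fin M, a p.1 p.2 • Kb (x p.2) p.1 := fun a =>
    (Fintype.sum_prod_type' fun k j => a k j • Kb (x j) k).symm
  have hobj : ∀ a : Fin (m D) → Fin M → ℝ, dualObjective m D M Y a =
      ∑ p : Fin (m D) × Fin M, a p.1 p.2 * Y p.1 p.2 := fun a =>
    (Fintype.sum_prod_type' fun k j => a k j * Y k j).symm
  have hY' : (fun p : Fin (m D) × Fin M => Y p.1 p.2) ≠ 0 := fun h =>
    hY (funext fun k => funext fun j => congrFun h (k, j))
  have hfeas : ‖∑ p : Fin (m D) × Fin M, c p.1 p.2 • Kb (x p.2) p.1‖ = 1 := by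
    rw [← hG]
    exact hc.1
  have hopt : ∀ a : Fin (m D) × Fin M → ℝ, ‖∑ p, a p • Kb (x p.2) p.1‖ = 1 →
      ∑ p, a p * Y p.1 p.2 ≤ ∑ p : Fin (m D) × Fin M, c p.1 p.2 * Y p.1 p.2 := fun a ha => by
    have h := hc.2 (fun k j => a (k, j)) (by rw [dualFeasible, hG]; exact ha)
    rwa [hobj, hobj] at h
  have hpos : 0 < dualObjective m D M Y c := by
    rw [hobj]
    exact dual_value_pos hLI hY' hopt
  obtain ⟨S, γ, hSne, hScard, hSg, hγ, hμeq⟩ := exists_dirac_representation hLI hY'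
    (fun p => c p.1 p.2) hfeas hopt (hset ▸ hμ)
  obtain ⟨w, p, hpS, hw, hwsum⟩ := exists_fin_indexing (E := SignedMeasure (Params m D)) S hSne
    (n := m D * M) (by simpa using hScard) γ
  have hghat : ∀ θ, ghat m D Kb M x Y c θ = dualObjective m D M Y c *
      (∑ p : Fin (m D) × Fin M, c p.1 p.2 • Kb (x p.2) p.1) θ := fun θ => by
    rw [ghat, hG]
    rfl
  have hnorm : ‖ghat m D Kb M x Y c‖ = dualObjective m D M Y c := by
    rw [ghat, hG, norm_smul, hfeas, mul_one, Real.norm_of_nonneg hpos.le]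
  refine ⟨w, p, ?_, fun ℓ => ?_, ?_⟩
  · rw [hw, hγ, hnorm, hobj]
  · rw [ThetaSet, Set.mem_ofPred_eq, hghat, hnorm, abs_mul, hSg _ (hpS ℓ), mul_one,
      abs_of_pos hpos]
  · rw [hwsum (fun θ => Real.sign (ghat m D Kb M x Y c θ))
      fun θ => (Measure.dirac θ).toSignedMeasure, hμeq]
    refine Finset.sum_congr rfl fun s hs => ?_
    congr 2
    rw [hghat]
    rcases eq_or_eq_neg_of_abs_eq (hSg s hs) with h | h
    · rw [h, mul_one, Real.sign_of_pos hpos]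
    · rw [h, mul_neg_one, Real.sign_of_neg (neg_neg_of_pos hpos)]

end
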